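/- arXiv:2501.02663 — 2 statements merged into one kernel-verified Lean document; each statement's English description precedes it below -/
import Mathlib

section
/- Let a be a symmetric positive-semidefinite 3×3 real matrix with trace 1, and let f = 1 − 27 det(a) be the alternative 3D hybrid-closure weighting factor. Then 0 ≤ det(a) ≤ 1/27, so 0 ≤ f ≤ 1; moreover f = 0 if and only if a = (1/3) I, and f = 1 whenever a = p pᵀ for a unit vector p ∈ ℝ³. -/
open Matrix

/-- For a symmetric positive-semidefinite `3×3` real matrix `a` with trace `1` and the
alternative 3D hybrid-closure weighting factor `f = 1 − 27 det a`, one has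
`0 ≤ det a ≤ 1/27` and `0 ≤ f ≤ 1`; moreover `f = 0` iff `a = (1/3) I`, and `f = 1` whenever
`a = p pᵀ` for a unit vector `p`. -/
theorem alternative_hybrid_weighting_factor_bounds
    (a : Matrix (Fin 3) (Fin 3) ℝ) (ha : a.PosSemidef) (htr : a.trace = 1) :
    (0 ≤ a.det) ∧ (a.det ≤ 1 / 27) ∧
    (0 ≤ 1 - 27 * a.det) ∧ (1 - 27 * a.det ≤ 1) ∧
    (1 - 27 * a.det = 0 ↔ a = (1 / 3 : ℝ) • (1 : Matrix (Fin 3) (Fin 3) ℝ)) ∧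
    (∀ p : EuclideanSpace ℝ (Fin 3), ‖p‖ = 1 →
      a = Matrix.of (fun i j => p i * p j) → 1 - 27 * a.det = 1) := by
  have hdet : a.det = ha.1.eigenvalues 0 * ha.1.eigenvalues 1 * ha.1.eigenvalues 2 := by
    rw [ha.1.det_eq_prod_eigenvalues, Fin.prod_univ_three]; simp
  have hsum : ha.1.eigenvalues 0 + ha.1.eigenvalues 1 + ha.1.eigenvalues 2 = 1 := by
    rw [← htr, ha.1.trace_eq_sum_eigenvalues, Fin.sum_univ_three]; simp
  have h0 := ha.eigenvalues_nonneg 0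
  have h1 := ha.eigenvalues_nonneg 1
  have h2 := ha.eigenvalues_nonneg 2
  have hspec := ha.1.spectral_theorem
  generalize hE : ha.1.eigenvalues = e at *
  have key : 1 - 27 * a.det = ((e 0 - e 1)^2 + (e 1 - e 2)^2 + (e 0 - e 2)^2) / 2
      + 3 * (e 0 * (e 1 - e 2)^2 + e 1 * (e 0 - e 2)^2 + e 2 * (e 0 - e 1)^2) := by
    have hz : e 2 = 1 - e 0 - e 1 := by linarith
    rw [hdet, hz]; ring
  have hp : 0 ≤ 3 * (e 0 * (e 1 - e 2)^2 + e 1 * (e 0 - e 2)^2 + e 2 * (e 0 - e 1)^2) := by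
    positivity
  have hf : 0 ≤ 1 - 27 * a.det := by rw [key]; positivity
  have hd : 0 ≤ a.det := by rw [hdet]; positivity
  refine ⟨hd, by linarith, hf, by linarith, ⟨fun h => ?_, fun h => ?_⟩, ?_⟩
  · rw [key] at h
    have e01 : e 0 - e 1 = 0 := by
      apply pow_eq_zero_iff (two_ne_zero) |>.1
      nlinarith [sq_nonneg (e 0 - e 1), sq_nonneg (e 1 - e 2), sq_nonneg (e 0 - e 2)]
    have e12 : e 1 - e 2 = 0 := by
      apply pow_eq_zero_iff (two_ne_zero) |>.1
      nlinarith [sq_nonneg (e 0 - e 1), sq_nonneg (e 1 - e 2), sq_nonneg (e 0 - e 2)]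
    have hd3 : diagonal ((RCLike.ofReal : ℝ → ℝ) ∘ e)
        = (1 / 3 : ℝ) • (1 : Matrix (Fin 3) (Fin 3) ℝ) := by
      rw [smul_one_eq_diagonal]
      congr 1
      funext i
      fin_cases i <;> simp <;> linarith
    rw [hd3, map_smul, map_one] at hspec
    exact hspec
  · rw [h]; simp [det_smul]; norm_num
  · intro p _ h
    rw [h, det_fin_three]
    simp only [of_apply]
    ring
end

section
/- Let K, M : ℝ → Matrix n n ℝ be matrix-valued functions differentiable at t₀, with K(t) and M(t) symmetric for all t, and let λ : ℝ → ℝ and Φ : ℝ → ℝⁿ be differentiable at t₀ and satisfy the generalized eigenproblem (K(t) − λ(t) M(t)) Φ(t) = 0 for all t, with Φ(t₀)ᵀ M(t₀) Φ(t₀) ≠ 0. Then λ'(t₀) = [Φ(t₀)ᵀ (K'(t₀) − λ(t₀) M'(t₀)) Φ(t₀)] / [Φ(t₀)ᵀ M(t₀) Φ(t₀)]. -/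
open Matrix

/-- Eigenvalue sensitivity for a parameterized generalized symmetric eigenproblem
`(K(t) − λ(t) M(t)) Φ(t) = 0`: at `t₀`, if `Φ(t₀)ᵀ M(t₀) Φ(t₀) ≠ 0`, then
`λ'(t₀) = Φ(t₀)ᵀ (K'(t₀) − λ(t₀) M'(t₀)) Φ(t₀) / (Φ(t₀)ᵀ M(t₀) Φ(t₀))`. -/
theorem generalized_eigenvalue_derivative
    {n : Type*} [Fintype n] [DecidableEq n]
    (K M : ℝ → Matrix n n ℝ) (lam : ℝ → ℝ) (Φ : ℝ → n → ℝ) (t₀ : ℝ)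
    (K' M' : Matrix n n ℝ) (lam' : ℝ) (Φ' : n → ℝ)
    (hK : ∀ i j, HasDerivAt (fun t => K t i j) (K' i j) t₀)
    (hM : ∀ i j, HasDerivAt (fun t => M t i j) (M' i j) t₀)
    (hlam : HasDerivAt lam lam' t₀)
    (hΦ : ∀ i, HasDerivAt (fun t => Φ t i) (Φ' i) t₀)
    (hKs : ∀ t, (K t)ᵀ = K t) (hMs : ∀ t, (M t)ᵀ = M t)
    (heig : ∀ t, (K t - lam t • M t).mulVec (Φ t) = 0)
    (hnz : Φ t₀ ⬝ᵥ (M t₀).mulVec (Φ t₀) ≠ 0) :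
    lam' = (Φ t₀ ⬝ᵥ (K' - lam t₀ • M').mulVec (Φ t₀)) /
      (Φ t₀ ⬝ᵥ (M t₀).mulVec (Φ t₀)) := by
  have hrow : (K' - lam t₀ • M').mulVec (Φ t₀) - lam' • (M t₀).mulVec (Φ t₀)
      + (K t₀ - lam t₀ • M t₀).mulVec Φ' = 0 := by
    funext i
    have h1 : HasDerivAt (fun t => ∑ j, (K t i j - lam t * M t i j) * Φ t j)
        (∑ j, ((K' i j - (lam' * M t₀ i j + lam t₀ * M' i j)) * Φ t₀ j
          + (K t₀ i j - lam t₀ * M t₀ i j) * Φ' j)) t₀ :=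
      HasDerivAt.fun_sum fun j _ => ((hK i j).sub (hlam.mul (hM i j))).mul (hΦ j)
    have h2 : (fun t => ∑ j, (K t i j - lam t * M t i j) * Φ t j) = fun _ => (0 : ℝ) := by
      funext t
      have := congrFun (heig t) i
      simpa [Matrix.mulVec, dotProduct] using this
    rw [h2] at h1
    have h3 := h1.unique (hasDerivAt_const t₀ (0 : ℝ))
    simp only [Matrix.mulVec, dotProduct, Pi.add_apply, Pi.sub_apply, Pi.smul_apply,
      Matrix.sub_apply, Matrix.smul_apply, smul_eq_mul, Pi.zero_apply]
    rw [← h3, Finset.mul_sum, ← Finset.sum_sub_distrib, ← Finset.sum_add_distrib]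
    exact Finset.sum_congr rfl fun j _ => by ring
  have hsymm : (K t₀ - lam t₀ • M t₀)ᵀ = K t₀ - lam t₀ • M t₀ := by
    rw [Matrix.transpose_sub, Matrix.transpose_smul, hKs, hMs]
  have hz : Φ t₀ ⬝ᵥ (K t₀ - lam t₀ • M t₀).mulVec Φ' = 0 := by
    rw [Matrix.dotProduct_mulVec, ← Matrix.mulVec_transpose, hsymm, heig, zero_dotProduct]
  have h := congrArg (fun v => Φ t₀ ⬝ᵥ v) hrow
  simp only [dotProduct_add, dotProduct_sub, dotProduct_smul, dotProduct_zero, hz,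
    smul_eq_mul] at h
  rw [eq_div_iff hnz]
  linarith
end
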